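/- For all nonempty words u and v over V, the reduced deconcatenation of u ≺ v satisfies Δ''(u ≺ v) = Σ (u¹ ≺ v¹) ⊗ (u² ⧢ v²), where the sum runs over all pairs of cuts u = u¹u², v = v¹v² with (u¹, v¹) ≠ (1, 1), and the operations on (possibly empty) factors follow the empty-word conventions (with 1⧢a = a⧢1 = a). -/

import Mathlib

open Finset MonoidAlgebra TensorProduct

/-- `Sh(p,q)`: permutations of the `p+q` indices that are increasing on the
first `p` indices and on the last `q` indices. -/
def IsSh (p q : ℕ) (σ : Equiv.Perm (Fin (p + q))) : Prop :=
  (∀ i j : Fin (p + q), (i : ℕ) < (j : ℕ) → (j : ℕ) < p → σ i < σ j) ∧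
  (∀ i j : Fin (p + q), p ≤ (i : ℕ) → (i : ℕ) < (j : ℕ) → σ i < σ j)

instance IsSh.decPred (p q : ℕ) : DecidablePred (IsSh p q) := fun _ => by
  unfold IsSh; infer_instance

/-- The word `u_{σ⁻¹(1)} u_{σ⁻¹(2)} ⋯ u_{σ⁻¹(p+q)}` where `u₁ ⋯ u_p` is `u` and
`u_{p+1} ⋯ u_{p+q}` is `v`. -/
def shWord {V : Type*} (u v : List V) (σ : Equiv.Perm (Fin (u.length + v.length))) :
    FreeMonoid V :=
  FreeMonoid.ofList
    (List.ofFn fun i => (u ++ v).get (Fin.cast (List.length_append (as := u) (bs := v)).symm (σ.symm i)))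

/-- `posCond p b i` says that the letter at (combined) index `i` comes from the second
word (`b = true`, i.e. `p ≤ i`) or from the first word (`b = false`, i.e. `i < p`). -/
def posCond (p : ℕ) (b : Bool) (i : ℕ) : Prop :=
  match b with
  | true => p ≤ i
  | false => i < p

instance posCond.dec (p : ℕ) (b : Bool) (i : ℕ) : Decidable (posCond p b i) := by
  cases b <;> unfold posCond <;> infer_instance

variable (k : Type*) [CommRing k] {V : Type*}

/-- The shuffle product `u ⧢ v` of two words, as an element of the monoid algebra
`H` of the free monoid on `V` (sum over all `(p,q)`-shuffles); in particular
`1 ⧢ a = a ⧢ 1 = a`. -/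
noncomputable def shuffleProd (u v : List V) : MonoidAlgebra k (FreeMonoid V) :=
  ∑ σ ∈ univ.filter (IsSh u.length v.length),
    MonoidAlgebra.single (shWord u v σ) (1 : k)

/-- Generic quadri-algebra operation on words: the part of the shuffle product `u ⧢ v`
consisting of the shuffles where the first (resp. last) letter comes from `v` iff `fb`
(resp. `lb`) is `true`.  (For a shuffle permutation, the first letter comes from `v`
iff `σ⁻¹(1) = p+1`, and from `u` iff `σ⁻¹(1) = 1`; the last letter comes from `v` iff
`σ⁻¹(p+q) = p+q`, and from `u` iff `σ⁻¹(p+q) = p`.)  This definition also encodes the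
empty-word conventions: `1 ↘ a = a` and `a ↖ 1 = a` for nonempty `a`, and all other
quadri-algebra operations with an empty argument are `0`. -/
noncomputable def quadOp (fb lb : Bool) (u v : List V) : MonoidAlgebra k (FreeMonoid V) :=
  ∑ σ ∈ univ.filter (fun σ : Equiv.Perm (Fin (u.length + v.length)) =>
      IsSh u.length v.length σ ∧
      ∃ h : 0 < u.length + v.length,
        posCond u.length fb (σ.symm ⟨0, h⟩) ∧
        posCond u.length lb (σ.symm ⟨u.length + v.length - 1, Nat.sub_lt h Nat.one_pos⟩)),
    MonoidAlgebra.single (shWord u v σ) (1 : k)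

/-- `u ↘ v` : shuffles whose first and last letters come from `v`. -/
noncomputable def seOp (u v : List V) : MonoidAlgebra k (FreeMonoid V) := quadOp k true true u v

/-- `u ↗ v` : shuffles whose first letter comes from `v` and last letter from `u`. -/
noncomputable def neOp (u v : List V) : MonoidAlgebra k (FreeMonoid V) := quadOp k true false u v

/-- `u ↖ v` : shuffles whose first and last letters come from `u`. -/
noncomputable def nwOp (u v : List V) : MonoidAlgebra k (FreeMonoid V) := quadOp k false false u v

/-- `u ↙ v` : shuffles whose first letter comes from `u` and last letter from `v`. -/
noncomputable def swOp (u v : List V) : MonoidAlgebra k (FreeMonoid V) := quadOp k false true u v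

/-- `u ≻ v := u ↗ v + u ↘ v`. -/
noncomputable def succOp (u v : List V) : MonoidAlgebra k (FreeMonoid V) := neOp k u v + seOp k u v

/-- `u ≺ v := u ↖ v + u ↙ v`. -/
noncomputable def precOp (u v : List V) : MonoidAlgebra k (FreeMonoid V) := nwOp k u v + swOp k u v

/-- `u ∨ v := u ↘ v + u ↙ v`. -/
noncomputable def veeOp (u v : List V) : MonoidAlgebra k (FreeMonoid V) := seOp k u v + swOp k u v

/-- `u ∧ v := u ↗ v + u ↖ v`. -/
noncomputable def wedgeOp (u v : List V) : MonoidAlgebra k (FreeMonoid V) := neOp k u v + nwOp k u v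

/-- Deconcatenation coproduct `Δ(u) = Σ_{u = u¹u²} u¹ ⊗ u²`, extended `k`-linearly. -/
noncomputable def deconc (x : MonoidAlgebra k (FreeMonoid V)) :
    MonoidAlgebra k (FreeMonoid V) ⊗[k] MonoidAlgebra k (FreeMonoid V) :=
  Finsupp.sum x.coeff fun a ca =>
    ca • ∑ i ∈ Finset.range ((FreeMonoid.toList a).length + 1),
      (MonoidAlgebra.single (FreeMonoid.ofList ((FreeMonoid.toList a).take i)) (1 : k)) ⊗ₜ[k]
        (MonoidAlgebra.single (FreeMonoid.ofList ((FreeMonoid.toList a).drop i)) (1 : k))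

namespace ShufAux

/-- Recursive list of all shuffles of two lists. -/
def shuf {α : Type*} : List α → List α → List (List α)
  | [], ys => [ys]
  | x :: xs, [] => [x :: xs]
  | x :: xs, y :: ys =>
      (shuf xs (y :: ys)).map (List.cons x) ++ (shuf (x :: xs) ys).map (List.cons y)
termination_by xs ys => xs.length + ys.length

theorem shuf_nil_left {α : Type*} (ys : List α) : shuf [] ys = [ys] := by simp [shuf]

theorem shuf_nil_right {α : Type*} (xs : List α) : shuf xs [] = [xs] := by
  cases xs <;> simp [shuf]

theorem shuf_cons {α : Type*} (x y : α) (xs ys : List α) :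
    shuf (x :: xs) (y :: ys) =
      (shuf xs (y :: ys)).map (List.cons x) ++ (shuf (x :: xs) ys).map (List.cons y) := by
  rw [shuf]

theorem shuf_map {α β : Type*} (f : α → β) (xs ys : List α) :
    shuf (xs.map f) (ys.map f) = (shuf xs ys).map (List.map f) := by
  induction xs, ys using shuf.induct with
  | case1 ys => simp [shuf_nil_left]
  | case2 x xs => simp [shuf_nil_right]
  | case3 x xs y ys ih1 ih2 =>
    simp only [List.map_cons] at ih1 ih2 ⊢
    rw [shuf_cons, shuf_cons, ih1, ih2]
    simp [Function.comp_def]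

theorem mem_shuf {α : Type*} (P : α → Bool) (l xs ys : List α)
    (hx : ∀ x ∈ xs, P x = true) (hy : ∀ y ∈ ys, P y = false) :
    l ∈ shuf xs ys ↔ l.filter P = xs ∧ l.filter (fun x => !P x) = ys := by
  induction xs, ys using shuf.induct generalizing l with
  | case1 ys =>
    simp only [shuf_nil_left, List.mem_singleton]
    constructor
    · rintro rfl
      simp only [List.filter_eq_nil_iff, List.filter_eq_self]
      simp_all
    · rintro ⟨h1, h2⟩
      rw [← h2, eq_comm, List.filter_eq_self]
      rw [List.filter_eq_nil_iff] at h1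
      simpa using h1
  | case2 x xs =>
    simp only [shuf_nil_right, List.mem_singleton]
    constructor
    · rintro rfl
      constructor
      · rw [List.filter_eq_self]; exact hx
      · rw [List.filter_eq_nil_iff]; intro a ha; simp [hx a ha]
    · rintro ⟨h1, h2⟩
      rw [← h1, eq_comm, List.filter_eq_self]
      rw [List.filter_eq_nil_iff] at h2
      simpa using h2
  | case3 x xs y ys ih1 ih2 =>
    have hPx := hx x (by simp)
    have hPy := hy y (by simp)
    have ih1' := fun l => ih1 l (fun a ha => hx a (by simp [ha])) hy
    have ih2' := fun l => ih2 l hx (fun a ha => hy a (by simp [ha]))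
    rw [shuf_cons]
    simp only [List.mem_append, List.mem_map, ih1', ih2']
    constructor
    · rintro (⟨a, ⟨h1, h2⟩, rfl⟩ | ⟨a, ⟨h1, h2⟩, rfl⟩)
      · simp [hPx, h1, h2]
      · simp [hPy, h1, h2]
    · rintro ⟨h1, h2⟩
      cases l with
      | nil => simp at h1
      | cons z l =>
        cases hz : P z with
        | true =>
          left
          simp [hz] at h1 h2
          exact ⟨l, ⟨h1.2, h2⟩, by rw [h1.1]⟩
        | false =>
          right
          simp [hz] at h1 h2
          exact ⟨l, ⟨h1, h2.2⟩, by rw [h2.1]⟩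

theorem nodup_shuf {α : Type*} (P : α → Bool) (xs ys : List α)
    (hx : ∀ x ∈ xs, P x = true) (hy : ∀ y ∈ ys, P y = false) :
    (shuf xs ys).Nodup := by
  induction xs, ys using shuf.induct with
  | case1 ys => simp [shuf_nil_left]
  | case2 x xs => simp [shuf_nil_right]
  | case3 x xs y ys ih1 ih2 =>
    have hPx := hx x (by simp)
    have hPy := hy y (by simp)
    rw [shuf_cons, List.nodup_append]
    refine ⟨(ih1 (fun a ha => hx a (by simp [ha])) hy).map (List.cons_injective),
      (ih2 hx (fun a ha => hy a (by simp [ha]))).map (List.cons_injective), ?_⟩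
    intro a ha b hb
    simp only [List.mem_map] at ha hb
    obtain ⟨a', -, rfl⟩ := ha
    obtain ⟨b', -, rfl⟩ := hb
    intro h
    simp only [List.cons.injEq] at h
    rw [h.1, hPy] at hPx
    cases hPx

/-- head of the list satisfies `P` -/
def headP {α : Type*} (P : α → Bool) : List α → Bool
  | [] => false
  | x :: _ => P x

theorem filter_shuf_cons {α : Type*} (P : α → Bool) (x : α) (xs ys : List α)
    (hx : P x = true) (hy : ∀ y ∈ ys, P y = false) :
    (shuf (x :: xs) ys).filter (headP P) = (shuf xs ys).map (List.cons x) := by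
  cases ys with
  | nil => simp [shuf_nil_right, headP, hx]
  | cons y ys =>
    have hPy := hy y (by simp)
    rw [shuf_cons, List.filter_append, List.filter_eq_self.2, List.filter_eq_nil_iff.2,
      List.append_nil]
    · intro a ha
      simp only [List.mem_map] at ha
      obtain ⟨a', -, rfl⟩ := ha
      simp [headP, hPy]
    · intro a ha
      simp only [List.mem_map] at ha
      obtain ⟨a', -, rfl⟩ := ha
      simp [headP, hx]

theorem filter_shuf_nil {α : Type*} (P : α → Bool) (ys : List α)
    (hy : ∀ y ∈ ys, P y = false) :
    (shuf [] ys).filter (headP P) = [] := by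
  cases ys with
  | nil => simp [shuf_nil_left, headP]
  | cons y ys => simp [shuf_nil_left, headP, hy y (by simp)]

/-- index list of a permutation -/
def idx {n : ℕ} (σ : Equiv.Perm (Fin n)) : List (Fin n) := List.ofFn fun i => σ.symm i

theorem idx_inj {n : ℕ} : Function.Injective (idx (n := n)) := by
  intro σ τ h
  have h2 := List.ofFn_injective h
  have : σ.symm = τ.symm := Equiv.ext fun i => congrFun h2 i
  simpa using congrArg Equiv.symm this

theorem idx_perm {n : ℕ} (σ : Equiv.Perm (Fin n)) : (idx σ).Perm (List.finRange n) := by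
  rw [List.perm_ext_iff_of_nodup]
  · intro a
    simp only [idx, List.mem_ofFn', List.mem_finRange, iff_true]
    exact ⟨σ a, by simp⟩
  · exact List.nodup_ofFn.2 σ.symm.injective
  · exact List.nodup_finRange n

theorem exists_idx {n : ℕ} (l : List (Fin n)) (h : l.Perm (List.finRange n)) :
    ∃ σ : Equiv.Perm (Fin n), idx σ = l := by
  have hlen : l.length = n := by simpa using h.length_eq
  have hnd : l.Nodup := h.nodup_iff.2 (List.nodup_finRange n)
  have hinj : Function.Injective (fun i : Fin n => l.get (Fin.cast hlen.symm i)) := by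
    intro i j hij
    have := List.nodup_iff_injective_get.1 hnd hij
    simpa using this
  refine ⟨(Equiv.ofBijective _ (Finite.injective_iff_bijective.1 hinj)).symm, ?_⟩
  apply List.ext_get
  · simp [idx, hlen]
  · intro i h1 h2
    simp [idx]

/-- the first block predicate -/
def isU (p : ℕ) {n : ℕ} (i : Fin n) : Bool := decide ((i : ℕ) < p)

theorem pairwise_finRange (n : ℕ) : (List.finRange n).Pairwise (· < ·) :=
  List.pairwise_lt_finRange n

theorem isSh_iff (p q : ℕ) (σ : Equiv.Perm (Fin (p + q))) :
    IsSh p q σ ↔ idx σ ∈ shuf ((List.finRange (p + q)).filter (isU p))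
      ((List.finRange (p + q)).filter (fun x => !isU p x)) := by
  rw [mem_shuf (isU p) _ _ _ (by simp) (by simp)]
  have key : ∀ (Q : Fin (p + q) → Bool), (idx σ).filter Q = (List.finRange (p + q)).filter Q ↔
      ∀ i j : Fin (p + q), Q i → Q j → i < j → σ i < σ j := by
    intro Q
    have h1 : (idx σ).filter Q = (List.finRange (p + q)).filter Q ↔
        ((idx σ).filter Q).Pairwise (· < ·) := by
      constructor
      · intro h
        rw [h]
        exact (pairwise_finRange _).filter _
      · intro h
        exact ((idx_perm σ).filter Q).eq_of_pairwise
          (fun a b _ _ h1 h2 => absurd h1 (not_lt.2 h2.le)) h ((pairwise_finRange _).filter _)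
    rw [h1, List.pairwise_filter, idx, List.pairwise_ofFn]
    constructor
    · intro h i j hi hj hij
      by_contra hlt
      have hne : σ j < σ i := lt_of_le_of_ne (not_lt.1 hlt) (fun e => hij.ne' (σ.injective e))
      have := h hne (by simpa using hj) (by simpa using hi)
      simp at this
      exact absurd hij (not_lt.2 this.le)
    · intro h i j hij hi hj
      by_contra hlt
      have hne : σ.symm j < σ.symm i :=
        lt_of_le_of_ne (not_lt.1 hlt) (fun e => hij.ne' (σ.symm.injective e))
      have := h _ _ hj hi hne
      simp at this
      exact absurd hij (not_lt.2 this.le)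
  rw [key, key]
  simp only [isU, IsSh, Fin.lt_def]
  constructor
  · rintro ⟨h1, h2⟩
    refine ⟨fun i j hi hj hij => h1 i j hij (by simpa using hj), fun i j hi hj hij =>
      h2 i j (by simpa using hi) hij⟩
  · rintro ⟨h1, h2⟩
    refine ⟨fun i j hij hj => h1 i j (by simp; omega) (by simp; omega) hij, fun i j hi hij =>
      h2 i j (by simp; omega) (by simp; omega) hij⟩

theorem sum_isSh {M : Type*} [AddCommMonoid M] (p q : ℕ) (R : List (Fin (p + q)) → Bool)
    (g : List (Fin (p + q)) → M) :
    ∑ σ ∈ univ.filter (fun σ : Equiv.Perm (Fin (p + q)) => IsSh p q σ ∧ R (idx σ) = true),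
      g (idx σ) =
    (((shuf ((List.finRange (p + q)).filter (isU p))
      ((List.finRange (p + q)).filter (fun x => !isU p x))).filter R).map g).sum := by
  have hnd := (nodup_shuf (isU p) ((List.finRange (p + q)).filter (isU p))
      ((List.finRange (p + q)).filter (fun x => !isU p x)) (by simp) (by simp)).filter R
  rw [← List.sum_toFinset g hnd]
  refine Finset.sum_bij (fun σ _ => idx σ) ?_ ?_ ?_ ?_
  · intro σ hσ
    simp only [Finset.mem_filter, Finset.mem_univ, true_and] at hσ
    simp only [List.mem_toFinset, List.mem_filter]
    exact ⟨(isSh_iff p q σ).1 hσ.1, hσ.2⟩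
  · intro σ _ τ _ h
    exact idx_inj h
  · intro l hl
    simp only [List.mem_toFinset, List.mem_filter] at hl
    obtain ⟨hl, hR⟩ := hl
    have hl2 := (mem_shuf (isU p) _ _ _ (by simp) (by simp)).1 hl
    have hp : l.Perm (List.finRange (p + q)) := by
      refine (List.filter_append_perm (isU p) l).symm.trans ?_
      rw [hl2.1, hl2.2]
      exact List.filter_append_perm (isU p) _
    obtain ⟨σ, rfl⟩ := exists_idx l hp
    refine ⟨σ, ?_, rfl⟩
    simp only [Finset.mem_filter, Finset.mem_univ, true_and]
    exact ⟨(isSh_iff p q σ).2 hl, hR⟩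
  · intros; rfl

/-- letter function -/
def letter (u v : List V) (i : Fin (u.length + v.length)) : V :=
  (u ++ v).get (Fin.cast (List.length_append (as := u) (bs := v)).symm i)

theorem shWord_eq (u v : List V) (σ : Equiv.Perm (Fin (u.length + v.length))) :
    shWord u v σ = FreeMonoid.ofList ((idx σ).map (letter u v)) := by
  simp only [shWord, idx, List.map_ofFn]
  rfl

theorem map_finRange (u v : List V) :
    (List.finRange (u.length + v.length)).map (letter u v) = u ++ v := by
  apply List.ext_get
  · simp
  · intro i h1 h2
    simp [letter]

theorem finRange_split (p q : ℕ) : List.finRange (p + q) =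
    (List.finRange (p + q)).filter (isU p) ++
      (List.finRange (p + q)).filter (fun x => !isU p x) := by
  refine ((List.filter_append_perm (isU p) _).symm).eq_of_pairwise (le := (· < ·))
    (fun a b _ _ h1 h2 => absurd h1 (not_lt.2 h2.le)) (pairwise_finRange _) ?_
  rw [List.pairwise_append]
  refine ⟨(pairwise_finRange _).filter _, (pairwise_finRange _).filter _, ?_⟩
  intro a ha b hb
  simp [isU] at ha hb
  rw [Fin.lt_def]
  omega

theorem length_filter_isU (p q : ℕ) :
    ((List.finRange (p + q)).filter (isU p)).length = p := by
  have h : ((List.finRange (p + q)).filter (isU p)) = (List.finRange p).map (Fin.castAdd q) := by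
    refine List.Perm.eq_of_pairwise (le := (· < ·))
      (fun a b _ _ h1 h2 => absurd h1 (not_lt.2 h2.le)) ((pairwise_finRange _).filter _) ?_ ?_
    · rw [List.pairwise_map]
      exact (pairwise_finRange p).imp (fun h => h)
    · rw [List.perm_ext_iff_of_nodup ((List.nodup_finRange _).filter _)
        ((List.nodup_finRange p).map (Fin.castAdd_injective p q))]
      intro a
      simp only [List.mem_filter, List.mem_finRange, true_and, isU, List.mem_map, decide_eq_true_eq]
      constructor
      · intro h
        exact ⟨⟨a, h⟩, rfl⟩
      · rintro ⟨b, rfl⟩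
        simp
  rw [h]; simp

theorem map_blocks (u v : List V) :
    ((List.finRange (u.length + v.length)).filter (isU u.length)).map (letter u v) = u ∧
    ((List.finRange (u.length + v.length)).filter (fun x => !isU u.length x)).map (letter u v)
      = v := by
  have h := map_finRange u v
  rw [finRange_split, List.map_append] at h
  exact List.append_inj h (by rw [List.length_map, length_filter_isU])

/-- sum of a list of words -/
noncomputable def S (L : List (List V)) : MonoidAlgebra k (FreeMonoid V) :=
  (L.map fun w => MonoidAlgebra.single (FreeMonoid.ofList w) (1 : k)).sum

theorem shuffleProd_eq (u v : List V) : shuffleProd k u v = S k (shuf u v) := by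
  have h := sum_isSh u.length v.length (fun _ => true)
    (fun l => MonoidAlgebra.single (FreeMonoid.ofList (l.map (letter u v))) (1 : k))
  obtain ⟨h1, h2⟩ := map_blocks u v
  have e := shuf_map (letter u v)
    ((List.finRange (u.length + v.length)).filter (isU u.length))
    ((List.finRange (u.length + v.length)).filter (fun x => !isU u.length x))
  rw [h1, h2] at e
  rw [e]
  simp only [and_true, List.filter_true] at h
  simp only [shuffleProd, shWord_eq, S, List.map_map, Function.comp_def]
  exact h

theorem headP_idx (p : ℕ) {n : ℕ} (σ : Equiv.Perm (Fin n)) :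
    headP (isU p) (idx σ) = true ↔ ∃ h : 0 < n, ((σ.symm ⟨0, h⟩ : Fin n) : ℕ) < p := by
  cases n with
  | zero => simp [idx, headP]
  | succ n => simp [idx, headP, isU, List.ofFn_succ]

theorem precOp_eq_sum (u v : List V) : precOp k u v =
    S k (((shuf ((List.finRange (u.length + v.length)).filter (isU u.length))
      ((List.finRange (u.length + v.length)).filter (fun x => !isU u.length x))).filter
        (headP (isU u.length))).map (List.map (letter u v))) := by
  have h := sum_isSh u.length v.length (headP (isU u.length))
    (fun l => MonoidAlgebra.single (FreeMonoid.ofList (l.map (letter u v))) (1 : k))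
  simp only [S, List.map_map, Function.comp_def]
  rw [← h]
  simp only [precOp, nwOp, swOp, quadOp, shWord_eq]
  rw [← Finset.sum_union]
  · apply Finset.sum_congr _ (fun _ _ => rfl)
    ext σ
    simp only [Finset.mem_union, Finset.mem_filter, Finset.mem_univ, true_and, headP_idx]
    simp only [posCond]
    constructor
    · rintro (⟨h1, h2, h3, -⟩ | ⟨h1, h2, h3, -⟩) <;> exact ⟨h1, h2, h3⟩
    · rintro ⟨h1, h2, h3⟩
      rcases lt_or_ge ((σ.symm ⟨u.length + v.length - 1, Nat.sub_lt h2 Nat.one_pos⟩ :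
        Fin (u.length + v.length)) : ℕ) u.length with h4 | h4
      · exact Or.inl ⟨h1, h2, h3, h4⟩
      · exact Or.inr ⟨h1, h2, h3, h4⟩
  · rw [Finset.disjoint_left]
    intro σ h1 h2
    simp only [Finset.mem_filter, Finset.mem_univ, true_and] at h1 h2
    simp only [posCond] at h1 h2
    obtain ⟨-, _, -, h3⟩ := h1
    obtain ⟨-, _, -, h4⟩ := h2
    omega

theorem precOp_nil (v : List V) : precOp k [] v = 0 := by
  rw [precOp_eq_sum]
  have h := (map_blocks ([] : List V) v).1
  rw [List.map_eq_nil_iff] at h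
  rw [h, filter_shuf_nil _ _ (by simp)]
  simp [S]

theorem S_map_cons (a : V) (L : List (List V)) : S k (L.map (List.cons a)) =
    MonoidAlgebra.single (FreeMonoid.of a) (1 : k) * S k L := by
  induction L with
  | nil => simp [S]
  | cons w L ih =>
    simp only [S, List.map_cons, List.sum_cons] at ih ⊢
    rw [mul_add, ← ih, MonoidAlgebra.single_mul_single, one_mul, FreeMonoid.ofList_cons]

theorem precOp_cons (a : V) (u v : List V) : precOp k (a :: u) v =
    MonoidAlgebra.single (FreeMonoid.of a) (1 : k) * S k (shuf u v) := by
  rw [precOp_eq_sum, ← S_map_cons]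
  obtain ⟨h1, h2⟩ := map_blocks (a :: u) v
  have hP : ∀ x ∈ ((List.finRange ((a :: u).length + v.length)).filter (isU (a :: u).length)),
    isU (a :: u).length x = true := by simp
  generalize (List.filter (isU (a :: u).length) (List.finRange ((a :: u).length + v.length))) = X
    at *
  cases X with
  | nil => simp at h1
  | cons x X =>
    rw [filter_shuf_cons _ _ _ _ (hP x (by simp)) (by simp)]
    simp only [List.map_cons, List.cons.injEq] at h1
    have e := shuf_map (letter (a :: u) v) X
      ((List.finRange ((a :: u).length + v.length)).filter (fun x => !isU (a :: u).length x))
    rw [h1.2, h2] at e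
    rw [e]
    simp [Function.comp_def, h1.1]

theorem S_shuf_cons (a b : V) (u v : List V) : S k (shuf (a :: u) (b :: v)) =
    MonoidAlgebra.single (FreeMonoid.of a) (1 : k) * S k (shuf u (b :: v)) +
    MonoidAlgebra.single (FreeMonoid.of b) (1 : k) * S k (shuf (a :: u) v) := by
  rw [← S_map_cons, ← S_map_cons, shuf_cons]
  simp [S]

theorem S_singleton (w : List V) :
    S k [w] = MonoidAlgebra.single (FreeMonoid.ofList w) (1 : k) := by simp [S]

theorem S_single_cons (a : V) (w : List V) :
    S k [a :: w] = MonoidAlgebra.single (FreeMonoid.of a) (1 : k) * S k [w] := by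
  rw [← S_map_cons]; simp

theorem deconc_add (x y : MonoidAlgebra k (FreeMonoid V)) :
    deconc k (x + y) = deconc k x + deconc k y := by
  classical
  unfold deconc
  rw [MonoidAlgebra.coeff_add]
  exact Finsupp.sum_add_index' (by simp) (by intros; rw [add_smul])

theorem deconc_zero : deconc k (0 : MonoidAlgebra k (FreeMonoid V)) = 0 := by
  simp [deconc]

theorem deconc_word (w : List V) : deconc k (S k [w]) =
    ∑ i ∈ Finset.range (w.length + 1), (S k [w.take i]) ⊗ₜ[k] (S k [w.drop i]) := by
  simp only [S_singleton]
  unfold deconc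
  rw [MonoidAlgebra.coeff_single, Finsupp.sum_single_index (by simp)]
  simp

theorem deconc_cons (a : V) (L : List (List V)) :
    deconc k (MonoidAlgebra.single (FreeMonoid.of a) (1 : k) * S k L) =
    (S k [[]]) ⊗ₜ[k] (MonoidAlgebra.single (FreeMonoid.of a) (1 : k) * S k L) +
    ((MonoidAlgebra.single (FreeMonoid.of a) (1 : k)) ⊗ₜ[k] 1) * deconc k (S k L) := by
  induction L with
  | nil => simp [S, deconc_zero]
  | cons w L ih =>
    have h : S k (w :: L) = S k [w] + S k L := by simp [S]
    rw [h, mul_add, deconc_add, deconc_add, ih, ← S_single_cons, deconc_word, deconc_word,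
      List.length_cons, Finset.sum_range_succ', mul_add, Finset.mul_sum, TensorProduct.tmul_add]
    simp only [List.take_succ_cons, List.drop_succ_cons, List.take_zero, List.drop_zero,
      Algebra.TensorProduct.tmul_mul_tmul, one_mul, ← S_single_cons]
    abel

theorem deconc_shuf (u v : List V) : deconc k (S k (shuf u v)) =
    ∑ i ∈ Finset.range (u.length + 1), ∑ j ∈ Finset.range (v.length + 1),
      (S k (shuf (u.take i) (v.take j))) ⊗ₜ[k] (S k (shuf (u.drop i) (v.drop j))) := by
  induction u, v using shuf.induct with
  | case1 ys => simp [shuf_nil_left, deconc_word]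
  | case2 x xs => simp [shuf_nil_right, deconc_word]
  | case3 a u b v ih1 ih2 =>
    rw [S_shuf_cons, deconc_add, deconc_cons, deconc_cons, ih1, ih2]
    simp only [List.length_cons]
    rw [Finset.sum_range_succ' _ (u.length + 1), Finset.sum_range_succ' _ (u.length + 1)]
    simp only [Finset.sum_range_succ' _ (v.length + 1)]
    simp only [List.take_succ_cons, List.drop_succ_cons, List.take_zero, List.drop_zero,
      shuf_nil_left, shuf_nil_right, S_shuf_cons, S_single_cons, mul_add, Finset.mul_sum,
      Finset.sum_add_distrib, TensorProduct.add_tmul, TensorProduct.tmul_add,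
      Algebra.TensorProduct.tmul_mul_tmul, one_mul]
    abel

end ShufAux

/-- `Δ''(u ≺ v) = Σ (u¹ ≺ v¹) ⊗ (u² ⧢ v²)`, sum over pairs of cuts with
`(u¹, v¹) ≠ (1, 1)`, where `Δ''(x) = Δ(x) - 1 ⊗ x`. -/
theorem statement18 (u v : List V) (hu : u ≠ []) (hv : v ≠ []) :
    deconc k (precOp k u v) -
        (MonoidAlgebra.single (FreeMonoid.ofList ([] : List V)) (1 : k)) ⊗ₜ[k] (precOp k u v) =
      ∑ p ∈ (Finset.range (u.length + 1) ×ˢ Finset.range (v.length + 1)).filter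
          (fun p => ¬(p.1 = 0 ∧ p.2 = 0)),
        (precOp k (u.take p.1) (v.take p.2)) ⊗ₜ[k]
          (shuffleProd k (u.drop p.1) (v.drop p.2)) := by
  open ShufAux in
  cases u with
  | nil => exact absurd rfl hu
  | cons a u =>
    rw [← S_singleton, precOp_cons, deconc_cons, add_sub_cancel_left, deconc_shuf]
    rw [Finset.sum_filter_of_ne, Finset.sum_product, List.length_cons, Finset.sum_range_succ' _ (u.length + 1)]
    · simp only [List.take_succ_cons, List.drop_succ_cons, List.take_zero, List.drop_zero,
        precOp_cons, precOp_nil, shuffleProd_eq, TensorProduct.zero_tmul, Finset.sum_const_zero,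
        add_zero, Finset.mul_sum, Algebra.TensorProduct.tmul_mul_tmul, one_mul]
    · rintro ⟨i, j⟩ - h ⟨h1, h2⟩
      simp only at h1 h2
      subst h1
      simp [precOp_nil] at h
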